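/- Let p > 1 and let d ≥ 3 be an integer. Consider the set S = {e_1, …, e_d} of standard unit vectors in ℓ_p^d, which is 2^{1/p}-equilateral. Then there are exactly two points x ∈ ℝ^d with ‖x − e_i‖_p = 2^{1/p} for all i ∈ [d]; both are scalar multiples of the all-ones vector j = (1,…,1): one is λj with λ the unique positive solution of |λ−1|^p + (d−1)λ^p = 2, the other is −μj with −μ the unique negative solution of this equation. Moreover ‖λj − (−μj)‖_p > 2^{1/p}. -/

import Mathlib

/-- The `p`-norm on `ℝ^d`. -/
noncomputable def pNorm {d : ℕ} (p : ℝ) (x : Fin d → ℝ) : ℝ :=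
  (∑ i, |x i| ^ p) ^ (1 / p)

open Finset in
/-- The `p`-th power of the `ℓ_p`-distance from `x` to a standard unit vector. -/
theorem sum_abs_sub_single_rpow {d : ℕ} (p : ℝ) (x : Fin d → ℝ) (i : Fin d) :
    ∑ j, |(x - Pi.single i 1 : Fin d → ℝ) j| ^ p = |x i - 1| ^ p - |x i| ^ p + ∑ j, |x j| ^ p := by
  rw [← add_sum_erase _ _ (mem_univ i), ← add_sum_erase _ (fun j => |x j| ^ p) (mem_univ i),
    sum_congr rfl fun j hj => by
      rw [Pi.sub_apply, Pi.single_eq_of_ne (ne_of_mem_erase hj), sub_zero]]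
  simp
  ring

theorem pNorm_eq_iff {d : ℕ} {p : ℝ} (hp : 0 < p) (x : Fin d → ℝ) :
    pNorm p x = (2 : ℝ) ^ (1 / p) ↔ ∑ i, |x i| ^ p = 2 :=
  Real.rpow_left_inj (Finset.sum_nonneg fun _ _ => by positivity) zero_le_two (by positivity)

theorem strictConvexOn_abs_rpow {p : ℝ} (hp : 1 < p) :
    StrictConvexOn ℝ Set.univ fun x : ℝ => |x| ^ p := by
  refine ⟨convex_univ, fun x _ y _ hxy a b ha hb hab => ?_⟩
  have hp0 : 0 < p := by linarith
  simp only [smul_eq_mul]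
  by_cases h : |x| = |y|
  · obtain rfl : x = -y := (abs_eq_abs.1 h).resolve_left hxy
    have hy : 0 < |y| := abs_pos.2 fun h0 => hxy (by simp [h0])
    have hlt : |a * -y + b * y| < |y| := by
      rw [show a * -y + b * y = (b - a) * y by ring, abs_mul]
      exact mul_lt_of_lt_one_left hy (abs_lt.2 ⟨by linarith, by linarith⟩)
    calc |a * -y + b * y| ^ p < |y| ^ p := Real.rpow_lt_rpow (abs_nonneg _) hlt hp0
      _ = a * |-y| ^ p + b * |y| ^ p := by rw [abs_neg, ← add_mul, hab, one_mul]
  · calc |a * x + b * y| ^ p ≤ (a * |x| + b * |y|) ^ p := by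
          refine Real.rpow_le_rpow (abs_nonneg _) ((abs_add_le _ _).trans_eq ?_) hp0.le
          rw [abs_mul, abs_mul, abs_of_pos ha, abs_of_pos hb]
      _ < a * |x| ^ p + b * |y| ^ p :=
          (strictConvexOn_rpow hp).2 (abs_nonneg x) (abs_nonneg y) h ha hb hab

theorem strictAnti_abs_sub_one_rpow_sub {p : ℝ} (hp : 1 < p) :
    StrictAnti fun t : ℝ => |t - 1| ^ p - |t| ^ p := by
  intro a b hab
  have hne : a - 1 ≠ b := by linarith
  have hD : 0 < b - a + 1 := by linarith
  have hu : 0 < (b - a) / (b - a + 1) := div_pos (by linarith) hD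
  have hv : 0 < 1 / (b - a + 1) := by positivity
  have huv : (b - a) / (b - a + 1) + 1 / (b - a + 1) = 1 := by field_simp
  have h₁ := (strictConvexOn_abs_rpow hp).2 (Set.mem_univ _) (Set.mem_univ _) hne hu hv huv
  have h₂ := (strictConvexOn_abs_rpow hp).2 (Set.mem_univ _) (Set.mem_univ _) hne hv hu
    (by rw [add_comm, huv])
  simp only [smul_eq_mul] at h₁ h₂
  rw [show (b - a) / (b - a + 1) * (a - 1) + 1 / (b - a + 1) * b = a by field_simp; ring] at h₁
  rw [show 1 / (b - a + 1) * (a - 1) + (b - a) / (b - a + 1) * b = b - 1 by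
    field_simp; ring] at h₂
  have hsum : ∀ u v A B : ℝ, u + v = 1 → (u * A + v * B) + (v * A + u * B) = A + B :=
    fun u v A B h => by linear_combination (A + B) * h
  have := hsum _ _ (|a - 1| ^ p) (|b| ^ p) huv
  dsimp only
  linarith

/-- The `p`-th power of the `ℓ_p`-distance in `ℝ^d` from `(t, …, t)` to a standard unit vector. -/
noncomputable def diagonalDist (p : ℝ) (d : ℕ) (t : ℝ) : ℝ :=
  |t - 1| ^ p + (d - 1 : ℝ) * |t| ^ p

theorem diagonalDist_zero {p : ℝ} (hp : 0 < p) (d : ℕ) : diagonalDist p d 0 = 1 := by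
  simp [diagonalDist, hp.ne']

theorem continuous_diagonalDist {p : ℝ} (hp : 0 ≤ p) (d : ℕ) : Continuous (diagonalDist p d) :=
  ((continuous_abs.comp (continuous_id.sub continuous_const)).rpow_const fun _ => .inr hp).add
    (continuous_const.mul (continuous_abs.rpow_const fun _ => .inr hp))

theorem convexOn_diagonalDist {p : ℝ} (hp : 1 < p) {d : ℕ} (hd : 1 ≤ d) :
    ConvexOn ℝ Set.univ (diagonalDist p d) := by
  have h := (strictConvexOn_abs_rpow hp).convexOn
  have hd' : (0 : ℝ) ≤ d - 1 := sub_nonneg.2 (by exact_mod_cast hd)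
  have h₁ : ConvexOn ℝ Set.univ fun t : ℝ => |t - 1| ^ p := by
    simpa [Function.comp_def, sub_eq_add_neg] using h.translate_left (-1)
  exact h₁.add (h.smul hd')

/-- The value `2` is attained at most once along each ray from the origin. -/
theorem diagonalDist_mul_lt_two {p : ℝ} (hp : 1 < p) {d : ℕ} (hd : 1 ≤ d) {s b : ℝ}
    (hs₀ : 0 ≤ s) (hs₁ : s < 1) (hb : diagonalDist p d b = 2) : diagonalDist p d (s * b) < 2 := by
  have h := (convexOn_diagonalDist hp hd).2 (Set.mem_univ 0) (Set.mem_univ b)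
    (sub_nonneg.2 hs₁.le) hs₀ (sub_add_cancel 1 s)
  simp only [smul_eq_mul, mul_zero, zero_add, hb, diagonalDist_zero (zero_lt_one.trans hp)] at h
  linarith

theorem eq_of_diagonalDist_eq_two {p : ℝ} (hp : 1 < p) {d : ℕ} (hd : 1 ≤ d) {a b : ℝ}
    (hab : 0 < a * b) (ha : diagonalDist p d a = 2) (hb : diagonalDist p d b = 2) : a = b := by
  have ha0 : a ≠ 0 := left_ne_zero_of_mul hab.ne'
  have hb0 : b ≠ 0 := right_ne_zero_of_mul hab.ne'
  have hq : 0 < a / b := by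
    rw [show a / b = a * b / b ^ 2 by field_simp]; positivity
  rcases lt_trichotomy (a / b) 1 with h | h | h
  · have := diagonalDist_mul_lt_two hp hd hq.le h hb
    rw [div_mul_cancel₀ _ hb0] at this
    exact absurd ha this.ne
  · exact (div_eq_one_iff_eq hb0).1 h
  · have h' : b / a < 1 := by rw [← inv_div]; exact inv_lt_one_of_one_lt₀ h
    have := diagonalDist_mul_lt_two hp hd (by rw [← inv_div]; positivity) h' ha
    rw [div_mul_cancel₀ _ ha0] at this
    exact absurd hb this.ne

theorem exists_pos_diagonalDist_eq_two {p : ℝ} (hp : 0 < p) {d : ℕ} (hd : 3 ≤ d) :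
    ∃ t, 0 < t ∧ t ≤ 1 ∧ diagonalDist p d t = 2 := by
  have hd' : (3 : ℝ) ≤ d := by exact_mod_cast hd
  have h0 := diagonalDist_zero hp d
  have h1 : 2 ≤ diagonalDist p d 1 := by
    simp only [diagonalDist, sub_self, abs_zero, Real.zero_rpow hp.ne', abs_one, Real.one_rpow]
    linarith
  obtain ⟨t, ht, h⟩ := intermediate_value_Icc zero_le_one
    (continuous_diagonalDist hp.le d).continuousOn ⟨h0.trans_le one_le_two, h1⟩
  refine ⟨t, lt_of_le_of_ne ht.1 ?_, ht.2, h⟩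
  rintro rfl
  linarith

theorem exists_neg_diagonalDist_eq_two {p : ℝ} (hp : 0 < p) {d : ℕ} (hd : 3 ≤ d) :
    ∃ t, 0 < t ∧ diagonalDist p d (-t) = 2 := by
  have hd' : (3 : ℝ) ≤ d := by exact_mod_cast hd
  have h0 := diagonalDist_zero hp d
  have h1 : 2 ≤ diagonalDist p d (-1) := by
    have : (0 : ℝ) ≤ |-1 - 1| ^ p := by positivity
    simp only [diagonalDist, abs_neg, abs_one, Real.one_rpow]
    linarith
  obtain ⟨t, ht, h⟩ := intermediate_value_Icc' (neg_nonpos.2 zero_le_one)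
    (continuous_diagonalDist hp.le d).continuousOn ⟨h0.trans_le one_le_two, h1⟩
  refine ⟨-t, neg_pos.2 (lt_of_le_of_ne ht.2 ?_), by rwa [neg_neg]⟩
  rintro rfl
  linarith

theorem two_lt_mul_add_rpow {p : ℝ} (hp : 1 < p) {d : ℕ} (hd : 1 ≤ d) {lam mu : ℝ}
    (hl₀ : 0 < lam) (hl₁ : lam ≤ 1) (hm : 0 < mu) (hl : diagonalDist p d lam = 2)
    (hmu : diagonalDist p d (-mu) = 2) : 2 < d * (lam + mu) ^ p := by
  have hd' : (1 : ℝ) ≤ d := by exact_mod_cast hd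
  have hl₂ : 0 ≤ 1 - lam := sub_nonneg.2 hl₁
  rw [diagonalDist, abs_sub_comm, abs_of_nonneg hl₂, abs_of_pos hl₀] at hl
  rw [diagonalDist, show -mu - 1 = -(1 + mu) by ring, abs_neg, abs_neg, abs_of_pos hm,
    abs_of_pos (by positivity)] at hmu
  have hB : (1 - lam) ^ p ≤ 1 := Real.rpow_le_one hl₂ (by linarith) (by linarith)
  have hL : 0 < lam ^ p := Real.rpow_pos_of_pos hl₀ p
  have hM : 0 < mu ^ p := Real.rpow_pos_of_pos hm p
  have h₁ : 1 + mu ^ p ≤ (1 + mu) ^ p := by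
    simpa using Real.add_rpow_le_rpow_add zero_le_one hm.le hp.le
  have h₂ : lam ^ p * (1 + mu) ^ p + mu ^ p * (1 - lam) ^ p ≤ (lam + mu) ^ p := by
    rw [← Real.mul_rpow hl₀.le (by positivity), ← Real.mul_rpow hm.le hl₂]
    refine (Real.add_rpow_le_rpow_add (by positivity) (by positivity) hp.le).trans_eq ?_
    congr 1
    ring
  generalize (lam + mu) ^ p = S at *
  generalize (1 + mu) ^ p = A at *
  generalize (1 - lam) ^ p = B at *
  generalize lam ^ p = L at *
  generalize mu ^ p = M at *
  obtain rfl : A = 2 - (d - 1) * M := by linarith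
  obtain rfl : B = 2 - (d - 1) * L := by linarith
  have h₃ : 0 ≤ (d * L - 1) * (1 - d * M) := mul_nonneg (by linarith) (by linarith)
  have h₄ : 0 < d * L * M := by positivity
  have h₅ := mul_le_mul_of_nonneg_left h₂ (by linarith : (0 : ℝ) ≤ d)
  linarith

/-- Let `p > 1` and `d ≥ 3`. The set `S = {e_1, …, e_d}` of standard unit
vectors in `ℓ_p^d` is `2^{1/p}`-equilateral, and there are exactly two points at
`ℓ_p`-distance `2^{1/p}` from all of `S`, namely `λ·(1,…,1)` and `−μ·(1,…,1)` where `λ`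
is the unique positive and `−μ` the unique negative solution of
`|t−1|^p + (d−1)|t|^p = 2`.  Moreover these two points are at distance `> 2^{1/p}`. -/
theorem statement6 (p : ℝ) (hp : 1 < p) (d : ℕ) (hd : 3 ≤ d) :
    (∀ i j : Fin d, i ≠ j →
      pNorm p (Pi.single i 1 - Pi.single j 1) = (2 : ℝ) ^ (1 / p)) ∧
    ∃ lam mu : ℝ, 0 < lam ∧ 0 < mu ∧
      (∀ t : ℝ, 0 < t → (|t - 1| ^ p + (d - 1 : ℝ) * |t| ^ p = 2 ↔ t = lam)) ∧
      (∀ t : ℝ, t < 0 → (|t - 1| ^ p + (d - 1 : ℝ) * |t| ^ p = 2 ↔ t = -mu)) ∧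
      (∀ x : Fin d → ℝ,
        (∀ i : Fin d, pNorm p (x - Pi.single i 1) = (2 : ℝ) ^ (1 / p)) ↔
          x = (fun _ => lam) ∨ x = (fun _ => -mu)) ∧
      (2 : ℝ) ^ (1 / p) < pNorm p ((fun _ => lam : Fin d → ℝ) - fun _ => -mu) := by
  have hp0 : 0 < p := by linarith
  have hd1 : 1 ≤ d := by lia
  have hdist : ∀ (x : Fin d → ℝ) (i : Fin d), pNorm p (x - Pi.single i 1) = (2 : ℝ) ^ (1 / p) ↔
      |x i - 1| ^ p - |x i| ^ p + ∑ j, |x j| ^ p = 2 := fun x i => by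
    rw [pNorm_eq_iff hp0, sum_abs_sub_single_rpow]
  have hdiag : ∀ (t : ℝ) (i : Fin d),
      pNorm p ((fun _ => t) - Pi.single i 1) = (2 : ℝ) ^ (1 / p) ↔ diagonalDist p d t = 2 :=
    fun t i => by
      rw [hdist, diagonalDist, Finset.sum_const, Finset.card_univ, Fintype.card_fin, nsmul_eq_mul,
        sub_one_mul, ← add_sub_assoc, sub_add_eq_add_sub]
  refine ⟨fun i j hij => ?_, ?_⟩
  · have h := sum_abs_sub_single_rpow p (0 : Fin d → ℝ) i
    simp only [zero_sub, Pi.neg_apply, abs_neg, Pi.zero_apply, abs_zero, abs_one, Real.one_rpow,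
      Real.zero_rpow hp0.ne', Finset.sum_const_zero] at h
    rw [hdist, h, Pi.single_eq_of_ne hij.symm, zero_sub, abs_neg, abs_one, abs_zero,
      Real.one_rpow, Real.zero_rpow hp0.ne']
    norm_num
  obtain ⟨lam, hl₀, hl₁, hl⟩ := exists_pos_diagonalDist_eq_two hp0 hd
  obtain ⟨mu, hm₀, hm⟩ := exists_neg_diagonalDist_eq_two hp0 hd
  have hpos : ∀ t : ℝ, 0 < t → (diagonalDist p d t = 2 ↔ t = lam) := fun t ht =>
    ⟨fun h => eq_of_diagonalDist_eq_two hp hd1 (mul_pos ht hl₀) h hl, fun h => h ▸ hl⟩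
  have hneg : ∀ t : ℝ, t < 0 → (diagonalDist p d t = 2 ↔ t = -mu) := fun t ht =>
    ⟨fun h => eq_of_diagonalDist_eq_two hp hd1 (mul_pos_of_neg_of_neg ht (neg_neg_of_pos hm₀)) h hm,
      fun h => h ▸ hm⟩
  refine ⟨lam, mu, hl₀, hm₀, hpos, hneg, fun x => ⟨fun h => ?_, ?_⟩, ?_⟩
  · obtain ⟨t, rfl⟩ : ∃ t, x = fun _ => t := by
      refine ⟨x ⟨0, hd1⟩, funext fun i => (strictAnti_abs_sub_one_rpow_sub hp).injective ?_⟩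
      have h₁ := (hdist x i).1 (h i)
      have h₂ := (hdist x ⟨0, hd1⟩).1 (h _)
      linarith
    have ht := (hdiag t ⟨0, hd1⟩).1 (h _)
    rcases lt_trichotomy t 0 with h0 | rfl | h0
    · exact .inr (by rw [(hneg t h0).1 ht])
    · rw [diagonalDist_zero hp0] at ht
      norm_num at ht
    · exact .inl (by rw [(hpos t h0).1 ht])
  · rintro (rfl | rfl) i
    · exact (hdiag lam i).2 hl
    · exact (hdiag (-mu) i).2 hm
  · refine Real.rpow_lt_rpow zero_le_two ?_ (by positivity)
    simp only [Pi.sub_apply, sub_neg_eq_add, Finset.sum_const, Finset.card_univ, Fintype.card_fin,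
      nsmul_eq_mul, abs_of_pos (add_pos hl₀ hm₀)]
    exact two_lt_mul_add_rpow hp hd1 hl₀ hl₁ hm₀ hl hm
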